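/- arXiv:1912.08388 — 2 statements merged into one kernel-verified Lean document; each statement's English description precedes it below -/
import Mathlib

section
/- Let (Ω, P) be a probability space, let T ≥ 1 and t be integers with 1 ≤ t ≤ T, and let Δ be a positive integer. For ℓ = 1, …, t−1, let V_ℓ ⊆ W_ℓ be events such that the pairs (W_ℓ, V_ℓ) are mutually independent across ℓ (i.e., the σ-algebras generated by the different pairs are independent), and suppose ∑_{ℓ=1}^{t−1} P(W_ℓ) ≤ ((t−1)/T) · Δ. Let B = ∑_{ℓ=1}^{t−1} 1_{W_ℓ} and let A0 = ⋂_{ℓ=1}^{t−1} V_ℓᶜ, and assume P(A0) > 0. Then P(B ≤ Δ − 1 | A0) ≥ 1 − (t−1)/T. -/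
open MeasureTheory ProbabilityTheory

/-- Conditioning on independent events `(V j)ᶜ` does not increase the probability of an event `W i`
containing `V i`, when the pairs `(W j, V j)` are independent. -/
theorem cond_iInter_compl_le {Ω ι : Type*} [Fintype ι] [MeasurableSpace Ω] {μ : Measure Ω}
    [IsProbabilityMeasure μ] {V W : ι → Set Ω} (hV : ∀ j, MeasurableSet (V j))
    (hVW : ∀ j, V j ⊆ W j)
    (hindep : iIndep (fun j => MeasurableSpace.generateFrom {W j, V j}) μ) (i : ι) :
    μ[W i | ⋂ j, (V j)ᶜ] ≤ μ (W i) := by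
  classical
  have hVgen (j : ι) : MeasurableSet[MeasurableSpace.generateFrom {W j, V j}] (V j)ᶜ :=
    (MeasurableSpace.measurableSet_generateFrom (by simp)).compl
  have hWgen : MeasurableSet[MeasurableSpace.generateFrom {W i, V i}] (W i) :=
    MeasurableSpace.measurableSet_generateFrom (by simp)
  have hprod : μ (⋂ j, (V j)ᶜ) = μ (V i)ᶜ * ∏ j ∈ Finset.univ.erase i, μ (V j)ᶜ := by
    rw [hindep.meas_iInter hVgen, Finset.mul_prod_erase _ (fun j => μ (V j)ᶜ) (Finset.mem_univ i)]
  have hinter : (⋂ j, (V j)ᶜ) ∩ W i =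
      ⋂ j, Function.update (fun j => (V j)ᶜ) i ((V i)ᶜ ∩ W i) j := by
    ext ω
    simp only [Set.mem_inter_iff, Set.mem_iInter]
    constructor
    · rintro ⟨hω, hi⟩ j
      rcases eq_or_ne j i with rfl | hj
      · simpa using ⟨hω j, hi⟩
      · simpa [hj] using hω j
    · intro hω
      have hi : ω ∈ (V i)ᶜ ∩ W i := by simpa using hω i
      refine ⟨fun j => ?_, hi.2⟩
      rcases eq_or_ne j i with rfl | hj
      · exact hi.1
      · simpa [hj] using hω j
  have hprod_inter : μ ((⋂ j, (V j)ᶜ) ∩ W i) =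
      μ ((V i)ᶜ ∩ W i) * ∏ j ∈ Finset.univ.erase i, μ (V j)ᶜ := by
    rw [hinter, hindep.meas_iInter, ← Finset.mul_prod_erase _ _ (Finset.mem_univ i)]
    · congr 1
      · simp
      · refine Finset.prod_congr rfl fun j hj => ?_
        rw [Function.update_of_ne (Finset.ne_of_mem_erase hj)]
    · intro j
      rcases eq_or_ne j i with rfl | hj
      · simpa using (hVgen j).inter hWgen
      · simpa [hj] using hVgen j
  have hdiff : μ ((V i)ᶜ ∩ W i) ≤ μ (W i) * μ (V i)ᶜ := by
    rw [← ENNReal.toReal_le_toReal (by finiteness) (by finiteness), ENNReal.toReal_mul]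
    change μ.real ((V i)ᶜ ∩ W i) ≤ μ.real (W i) * μ.real (V i)ᶜ
    rw [Set.inter_comm, ← Set.sdiff_eq, measureReal_sdiff (hVW i) (hV i),
      probReal_compl_eq_one_sub (hV i)]
    nlinarith [measureReal_nonneg (μ := μ) (s := V i), measureReal_le_one (μ := μ) (s := W i)]
  rw [cond_apply (MeasurableSet.iInter fun j => (hV j).compl), mul_comm, ← div_eq_mul_inv]
  refine ENNReal.div_le_of_le_mul ?_
  rw [hprod_inter, hprod, ← mul_assoc]
  gcongr

/-- Markov's inequality for the number of events `W i` that occur. -/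
theorem mul_measureReal_le_sum_indicator_le {Ω ι : Type*} [Fintype ι] [MeasurableSpace Ω]
    (ν : Measure Ω) [IsFiniteMeasure ν] {W : ι → Set Ω} (hW : ∀ i, MeasurableSet (W i)) (c : ℝ) :
    c * ν.real {ω | c ≤ ∑ i, (W i).indicator (fun _ => (1 : ℝ)) ω} ≤ ∑ i, ν.real (W i) := by
  have hint (i : ι) : Integrable ((W i).indicator fun _ => (1 : ℝ)) ν :=
    (integrable_const 1).indicator (hW i)
  have hmarkov := mul_meas_ge_le_integral_of_nonneg (μ := ν)
    (f := fun ω => ∑ i, (W i).indicator (fun _ => (1 : ℝ)) ω)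
    (.of_forall fun ω => Finset.sum_nonneg fun i _ => Set.indicator_nonneg (by simp) ω)
    (integrable_finsetSum _ fun i _ => hint i) c
  rw [integral_finsetSum _ fun i _ => hint i] at hmarkov
  simpa [integral_indicator_const, hW] using hmarkov

/-- Lemma 2 of the paper: with `V_ℓ ⊆ W_ℓ` for `ℓ = 1, …, t-1`, the pairs `(W_ℓ, V_ℓ)`
mutually independent across `ℓ`, and `∑_ℓ P(W_ℓ) ≤ ((t-1)/T) Δ`, conditioned on the
event `A0 = ⋂_ℓ V_ℓᶜ` (of positive probability), the count `B = ∑_ℓ 1_{W_ℓ}` stays at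
most `Δ - 1` with probability at least `1 - (t-1)/T`. -/
theorem stmt_3 {Ω : Type*} [MeasurableSpace Ω] (μ : Measure Ω) [IsProbabilityMeasure μ]
    (T t : ℕ) (hT : 1 ≤ T) (ht1 : 1 ≤ t) (htT : t ≤ T)
    (Δ : ℕ) (hΔ : 0 < Δ)
    (V W : Fin (t - 1) → Set Ω)
    (hVmeas : ∀ ℓ, MeasurableSet (V ℓ)) (hWmeas : ∀ ℓ, MeasurableSet (W ℓ))
    (hVW : ∀ ℓ, V ℓ ⊆ W ℓ)
    (hindep : iIndep (fun ℓ => MeasurableSpace.generateFrom {W ℓ, V ℓ}) μ)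
    (hWsum : ∑ ℓ, (μ (W ℓ)).toReal ≤ (((t : ℝ) - 1) / T) * Δ)
    (hA0 : 0 < μ (⋂ ℓ, (V ℓ)ᶜ)) :
    ENNReal.ofReal (1 - ((t : ℝ) - 1) / T) ≤
      μ[{ω | ∑ ℓ, (W ℓ).indicator (fun _ => (1 : ℝ)) ω ≤ (Δ : ℝ) - 1} | ⋂ ℓ, (V ℓ)ᶜ] := by
  set A := ⋂ ℓ, (V ℓ)ᶜ
  have : IsProbabilityMeasure μ[|A] := cond_isProbabilityMeasure hA0.ne'
  set S := {ω | ∑ ℓ, (W ℓ).indicator (fun _ => (1 : ℝ)) ω ≤ (Δ : ℝ) - 1}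
  have hS : MeasurableSet S := measurableSet_le
    (Finset.measurable_sum _ fun ℓ _ => measurable_const.indicator (hWmeas ℓ)) measurable_const
  have hcompl : Sᶜ ⊆ {ω | (Δ : ℝ) ≤ ∑ ℓ, (W ℓ).indicator (fun _ => (1 : ℝ)) ω} := by
    classical
    intro ω hω
    simp only [S, Set.mem_compl_iff, Set.mem_ofPred_eq, not_le, Set.indicator_apply,
      Finset.sum_boole] at hω ⊢
    rw [sub_lt_iff_lt_add] at hω
    exact_mod_cast Nat.lt_succ_iff.mp (by exact_mod_cast hω)
  have hcond : ∑ ℓ, μ[|A].real (W ℓ) ≤ ∑ ℓ, (μ (W ℓ)).toReal :=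
    Finset.sum_le_sum fun ℓ _ =>
      ENNReal.toReal_mono (by finiteness) (cond_iInter_compl_le hVmeas hVW hindep ℓ)
  have hΔ' : (0 : ℝ) < Δ := by exact_mod_cast hΔ
  have htail : μ[|A].real Sᶜ ≤ ((t : ℝ) - 1) / T := by
    refine le_of_mul_le_mul_left ?_ hΔ'
    calc (Δ : ℝ) * μ[|A].real Sᶜ
        ≤ Δ * μ[|A].real {ω | (Δ : ℝ) ≤ ∑ ℓ, (W ℓ).indicator (fun _ => (1 : ℝ)) ω} := by
          gcongr; finiteness
      _ ≤ ∑ ℓ, μ[|A].real (W ℓ) := mul_measureReal_le_sum_indicator_le _ hWmeas _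
      _ ≤ Δ * (((t : ℝ) - 1) / T) := by linarith
  rw [probReal_compl_eq_one_sub hS] at htail
  refine ENNReal.ofReal_le_of_le_toReal ?_
  change _ ≤ μ[|A].real S
  linarith
end

section
/- Let (Ω, P) be a probability space, let T ≥ 1 and t be integers with 1 ≤ t ≤ T, and let Δ be a positive integer. For ℓ = 1, …, t−1, let V_ℓ ⊆ W_ℓ be events such that the pairs (W_ℓ, V_ℓ) are mutually independent across ℓ, with P(V_ℓ) ≤ 1/T for every ℓ and ∑_{ℓ=1}^{t−1} P(W_ℓ) ≤ ((t−1)/T) · Δ. Then P( (⋂_{ℓ=1}^{t−1} V_ℓᶜ) ∩ { ∑_{ℓ=1}^{t−1} 1_{W_ℓ} ≤ Δ − 1 } ) ≥ (1 − 1/T)^{t−1} · (1 − (t−1)/T). -/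
open MeasureTheory ProbabilityTheory

section

variable {Ω ι : Type*} [MeasurableSpace Ω] {μ : Measure Ω} [Fintype ι]

/-- If `V i ⊆ W i` and the pairs `(W i, V i)` are independent, then each `W i` is negatively
correlated with the event that no `V j` occurs. -/
theorem measureReal_iInter_compl_inter_le [IsProbabilityMeasure μ] {V W : ι → Set Ω}
    (hWmeas : ∀ i, MeasurableSet (W i))
    (hVW : ∀ i, V i ⊆ W i)
    (hindep : iIndep (fun i => MeasurableSpace.generateFrom {W i, V i}) μ) (i : ι) :
    μ.real ((⋂ j, (V j)ᶜ) ∩ W i) ≤ μ.real (⋂ j, (V j)ᶜ) * μ.real (W i) := by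
  classical
  have hV : ∀ j, MeasurableSet[MeasurableSpace.generateFrom {W j, V j}] (V j)ᶜ := fun j =>
    (MeasurableSpace.measurableSet_generateFrom (by simp)).compl
  have hW : ∀ j, MeasurableSet[MeasurableSpace.generateFrom {W j, V j}] (W j)ᶜ := fun j =>
    (MeasurableSpace.measurableSet_generateFrom (by simp)).compl
  set U : ι → Set Ω := fun j => if j = i then (W j)ᶜ else (V j)ᶜ with hU
  have hinter : (⋂ j, (V j)ᶜ) \ W i = ⋂ j, U j := by
    ext ω
    simp only [Set.mem_sdiff, Set.mem_iInter, Set.mem_compl_iff, hU]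
    refine ⟨fun h j => ?_, fun h => ⟨fun j hj => ?_, ?_⟩⟩
    · split_ifs with hji
      · subst hji
        exact h.2
      · exact h.1 j
    · have := h j
      split_ifs at this
      · exact this (hVW j hj)
      · exact this hj
    · simpa using h i
  have hUprod : μ.real (⋂ j, U j) = ∏ j, μ.real (U j) := by
    simp only [Measure.real]
    rw [hindep.meas_iInter, ENNReal.toReal_prod]
    intro j
    simp only [hU]
    split_ifs
    exacts [hW j, hV j]
  have hVprod : μ.real (⋂ j, (V j)ᶜ) = ∏ j, μ.real (V j)ᶜ := by
    simp only [Measure.real]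
    rw [hindep.meas_iInter hV, ENNReal.toReal_prod]
  have hle : μ.real (⋂ j, (V j)ᶜ) * (1 - μ.real (W i)) ≤ μ.real (⋂ j, U j) := by
    rw [hUprod, hVprod, ← probReal_compl_eq_one_sub (hWmeas i),
      ← Finset.prod_erase_mul _ _ (Finset.mem_univ i),
      ← Finset.prod_erase_mul _ (fun j => μ.real (U j)) (Finset.mem_univ i)]
    have hprod : ∏ j ∈ Finset.univ.erase i, μ.real (U j) =
        ∏ j ∈ Finset.univ.erase i, μ.real (V j)ᶜ :=
      Finset.prod_congr rfl fun j hj => by simp [hU, Finset.ne_of_mem_erase hj]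
    have hUi : U i = (W i)ᶜ := by simp [hU]
    rw [hprod, hUi]
    refine mul_le_mul_of_nonneg_right ?_ measureReal_nonneg
    exact mul_le_of_le_one_right (Finset.prod_nonneg fun _ _ => measureReal_nonneg)
      measureReal_le_one
  have hsplit := measureReal_inter_add_sdiff (μ := μ) (s := ⋂ j, (V j)ᶜ) (hWmeas i)
  rw [hinter] at hsplit
  linarith

/-- Markov's inequality on an event `A` for the number of the events `W i` that occur. -/
theorem mul_measureReal_inter_le_sum_indicator [IsFiniteMeasure μ] {A : Set Ω} {W : ι → Set Ω}
    (hWmeas : ∀ i, MeasurableSet (W i)) (c : ℝ) :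
    c * μ.real (A ∩ {ω | c ≤ ∑ i, (W i).indicator (fun _ => (1 : ℝ)) ω}) ≤
      ∑ i, μ.real (A ∩ W i) := by
  have hint : ∀ i, Integrable ((W i).indicator fun _ => (1 : ℝ)) (μ.restrict A) := fun i =>
    (integrable_const 1).indicator (hWmeas i)
  have hmeas : MeasurableSet {ω | c ≤ ∑ i, (W i).indicator (fun _ => (1 : ℝ)) ω} :=
    measurableSet_le measurable_const
      (Finset.measurable_sum _ fun i _ => measurable_const.indicator (hWmeas i))
  have h := mul_meas_ge_le_integral_of_nonneg (μ := μ.restrict A)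
    (f := fun ω => ∑ i, (W i).indicator (fun _ => (1 : ℝ)) ω)
    (ae_of_all _ fun ω => Finset.sum_nonneg fun i _ =>
      Set.indicator_nonneg (fun _ _ => zero_le_one) ω)
    (integrable_finsetSum _ fun i _ => hint i) c
  rw [integral_finsetSum _ fun i _ => hint i, measureReal_restrict_apply hmeas] at h
  simpa [integral_indicator_const, measureReal_restrict_apply, hWmeas, Set.inter_comm] using h

end

/-- The driver-availability bound in the proof of Theorem 1 of the paper: with
`V_ℓ ⊆ W_ℓ` for `ℓ = 1, …, t-1`, the pairs `(W_ℓ, V_ℓ)` mutually independent across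
`ℓ`, `P(V_ℓ) ≤ 1/T` for every `ℓ`, and `∑_ℓ P(W_ℓ) ≤ ((t-1)/T) Δ`, the joint event
that no `V_ℓ` occurs and `∑_ℓ 1_{W_ℓ} ≤ Δ - 1` has probability at least
`(1 - 1/T)^(t-1) · (1 - (t-1)/T)`. -/
theorem stmt_4 {Ω : Type*} [MeasurableSpace Ω] (μ : Measure Ω) [IsProbabilityMeasure μ]
    (T t : ℕ) (hT : 1 ≤ T) (ht1 : 1 ≤ t) (htT : t ≤ T)
    (Δ : ℕ) (hΔ : 0 < Δ)
    (V W : Fin (t - 1) → Set Ω)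
    (hVmeas : ∀ ℓ, MeasurableSet (V ℓ)) (hWmeas : ∀ ℓ, MeasurableSet (W ℓ))
    (hVW : ∀ ℓ, V ℓ ⊆ W ℓ)
    (hindep : iIndep (fun ℓ => MeasurableSpace.generateFrom {W ℓ, V ℓ}) μ)
    (hVprob : ∀ ℓ, μ (V ℓ) ≤ ENNReal.ofReal (1 / (T : ℝ)))
    (hWsum : ∑ ℓ, (μ (W ℓ)).toReal ≤ (((t : ℝ) - 1) / T) * Δ) :
    ENNReal.ofReal ((1 - 1 / (T : ℝ)) ^ (t - 1) * (1 - ((t : ℝ) - 1) / T)) ≤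
      μ ((⋂ ℓ, (V ℓ)ᶜ) ∩
        {ω | ∑ ℓ, (W ℓ).indicator (fun _ => (1 : ℝ)) ω ≤ (Δ : ℝ) - 1}) := by
  have hT0 : (0 : ℝ) < T := by exact_mod_cast hT
  have hΔ0 : (0 : ℝ) < Δ := by exact_mod_cast hΔ
  have htT' : ((t : ℝ) - 1) / T ≤ 1 := by
    rw [div_le_one hT0]
    have : (t : ℝ) ≤ T := by exact_mod_cast htT
    linarith
  have hT1 : 0 ≤ 1 - 1 / (T : ℝ) := by
    rw [sub_nonneg, div_le_one hT0]
    exact_mod_cast hT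
  set A := ⋂ ℓ, (V ℓ)ᶜ
  set S : Ω → ℝ := fun ω => ∑ ℓ, (W ℓ).indicator (fun _ => (1 : ℝ)) ω with hS
  have hA : (1 - 1 / (T : ℝ)) ^ (t - 1) ≤ μ.real A := by
    have hprod : μ.real A = ∏ ℓ, μ.real (V ℓ)ᶜ := by
      simp only [Measure.real, A]
      rw [hindep.meas_iInter fun ℓ =>
        (MeasurableSpace.measurableSet_generateFrom (by simp)).compl, ENNReal.toReal_prod]
    calc (1 - 1 / (T : ℝ)) ^ (t - 1) = ∏ _ℓ : Fin (t - 1), (1 - 1 / (T : ℝ)) := by simp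
      _ ≤ ∏ ℓ, μ.real (V ℓ)ᶜ := Finset.prod_le_prod (fun _ _ => hT1) fun ℓ _ => by
        rw [probReal_compl_eq_one_sub (hVmeas ℓ)]
        exact sub_le_sub_left (ENNReal.toReal_le_of_le_ofReal (by positivity) (hVprob ℓ)) 1
      _ = μ.real A := hprod.symm
  have hmarkov : μ.real (A ∩ {ω | (Δ : ℝ) ≤ S ω}) ≤ μ.real A * (((t : ℝ) - 1) / T) := by
    refine le_of_mul_le_mul_left ?_ hΔ0
    calc (Δ : ℝ) * μ.real (A ∩ {ω | (Δ : ℝ) ≤ S ω}) ≤ ∑ ℓ, μ.real (A ∩ W ℓ) :=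
          mul_measureReal_inter_le_sum_indicator hWmeas _
      _ ≤ ∑ ℓ, μ.real A * μ.real (W ℓ) := Finset.sum_le_sum fun ℓ _ =>
          measureReal_iInter_compl_inter_le hWmeas hVW hindep ℓ
      _ = μ.real A * ∑ ℓ, μ.real (W ℓ) := by rw [Finset.mul_sum]
      _ ≤ μ.real A * ((((t : ℝ) - 1) / T) * Δ) :=
          mul_le_mul_of_nonneg_left hWsum measureReal_nonneg
      _ = Δ * (μ.real A * (((t : ℝ) - 1) / T)) := by ring
  have hcover : A ⊆ (A ∩ {ω | S ω ≤ (Δ : ℝ) - 1}) ∪ (A ∩ {ω | (Δ : ℝ) ≤ S ω}) := by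
    classical
    intro ω hω
    rw [← Set.inter_union_distrib_left]
    refine ⟨hω, ?_⟩
    obtain ⟨n, hn⟩ : ∃ n : ℕ, S ω = n :=
      ⟨(Finset.univ.filter fun ℓ => ω ∈ W ℓ).card, by
        simp only [hS, Set.indicator_apply, Finset.sum_boole]⟩
    rcases lt_or_ge n Δ with h | h
    · left
      have : (n : ℝ) + 1 ≤ Δ := by exact_mod_cast h
      simp only [Set.mem_ofPred_eq, hn]
      linarith
    · right
      simpa only [Set.mem_ofPred_eq, hn, Nat.cast_le] using h
  have hunion := (measureReal_mono (μ := μ) hcover).trans (measureReal_union_le _ _)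
  refine ENNReal.ofReal_le_of_le_toReal ?_
  calc (1 - 1 / (T : ℝ)) ^ (t - 1) * (1 - ((t : ℝ) - 1) / T)
      ≤ μ.real A * (1 - ((t : ℝ) - 1) / T) :=
        mul_le_mul_of_nonneg_right hA (sub_nonneg.2 htT')
    _ ≤ μ.real (A ∩ {ω | S ω ≤ (Δ : ℝ) - 1}) := by linarith
end
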